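/- Let S be a finite nonempty set of states, A = ∏_{i=1}^n A^i with each A^i finite and nonempty, r^i : S × A → ℝ stage payoffs, γ^i ∈ [0,1) discount factors, p : S × A → Δ(S) transition probabilities, τ > 0, and let η denote the entropy perturbation on each Δ(A^i). Then for any horizon length ℓ + 1 there exist stage strategies π_k^i(s) ∈ Δ(A^i) and Q-functions Q_k^i : S × A → ℝ, for k = 0,…,ℓ, satisfying: (i) Q_ℓ^i(s,a) = r^i(s,a); (ii) Q_k^i(s,a) = r^i(s,a) + γ^i Σ_{s'∈S} p(s'|s,a) E_{a'∼π_{k+1}(s')}[Q_{k+1}^i(s',a')] for all k < ℓ, where π_{k+1}(s') is the product of the π_{k+1}^j(s'); and (iii) for every k, s, and i, π_k^i(s) maximizes over μ ∈ Δ(A^i) the objective E_{(μ, π_k^{-i}(s))}[Q_k^i(s,a)] + τ η(μ). That is, every finite-horizon stochastic game admits a (nonstationary Markov) Nash distribution together with its associated Q-functions. -/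

import Mathlib

open Finset

/-- A set `U` is dominant for the family of orders induced by `v` if no point lies strictly above
the minimum of `U` in all of the orders simultaneously. -/
def Dominant {I V α : Type*} [LinearOrder α] (v : I → V → α) (U : Finset V) : Prop :=
  ∀ y, ∃ i, ∀ u ∈ U, v i y ≤ v i u

section Scarf

variable {I V α : Type*} [LinearOrder α] {v : I → V → α}

theorem Dominant.mono {U W : Finset V} (h : Dominant v W) (hUW : U ⊆ W) : Dominant v U := by
  intro y
  obtain ⟨i, hi⟩ := h y
  exact ⟨i, fun u hu => hi u (hUW hu)⟩

variable [Fintype I] [DecidableEq I] [DecidableEq V]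

/-- If `c` colours a set of `|I|` points without using all colours, the number of points whose
removal leaves precisely the colours other than `o` is even. -/
theorem even_card_erase_image_eq (c : V → I) (o : I) {U : Finset V}
    (hU : U.card = Fintype.card I) (hc : U.image c ≠ univ) :
    Even (U.filter fun x => (U.erase x).image c = univ.erase o).card := by
  by_cases h : ∃ x ∈ U, (U.erase x).image c = univ.erase o
  · obtain ⟨x, hxU, hx⟩ := h
    have hcx : c x ≠ o := by
      intro h
      apply hc
      rw [← insert_erase hxU, image_insert, hx, h, insert_erase (mem_univ o)]
    have hcxm : c x ∈ (U.erase x).image c := by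
      rw [hx]; exact mem_erase.2 ⟨hcx, mem_univ _⟩
    obtain ⟨y, hy, hyx⟩ := mem_image.1 hcxm
    have hyU := mem_of_mem_erase hy
    have hyne : y ≠ x := ne_of_mem_erase hy
    have hinj : Set.InjOn c (U.erase x) := by
      rw [← card_image_iff, hx, card_erase_of_mem (mem_univ _), card_erase_of_mem hxU, hU,
        card_univ]
    have : (U.filter fun x => (U.erase x).image c = univ.erase o) = {x, y} := by
      ext z
      simp only [mem_filter, mem_insert, mem_singleton]
      constructor
      · rintro ⟨hzU, hz⟩
        by_contra hne
        push Not at hne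
        have hzx : z ∈ U.erase x := mem_erase.2 ⟨hne.1, hzU⟩
        have : c z ∈ (U.erase z).image c := by
          rw [hz, ← hx]; exact mem_image_of_mem _ hzx
        obtain ⟨w, hw, hwz⟩ := mem_image.1 this
        by_cases hwx : w = x
        · subst hwx
          exact hne.2 (hinj hzx hy (by rw [← hwz, hyx]))
        · exact ne_of_mem_erase hw
            (hinj (mem_coe.2 (mem_erase.2 ⟨hwx, mem_of_mem_erase hw⟩)) hzx hwz)
      · rintro (rfl | rfl)
        · exact ⟨hxU, hx⟩
        · refine ⟨hyU, ?_⟩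
          have h1 : U.erase z = insert x ((U.erase x).erase z) := by
            ext w
            simp only [mem_erase, mem_insert]
            by_cases hw : w = x
            · subst hw; simp [hyne.symm, hxU]
            · simp [hw]
          rw [h1, image_insert, ← hyx, ← image_insert, insert_erase hy, hx]
    rw [this, card_pair hyne.symm]
    exact even_two
  · push Not at h
    rw [filter_false_of_mem h]
    simp

variable [Fintype V]

open Classical in
/-- A dominant set of corank one that contains a non-slack point extends to a dominant set of
full rank in exactly two ways. -/
theorem card_dominant_insert_eq_two (hv : ∀ i, Function.Injective (v i)) (s : I → V)
    (hs : ∀ i k, k ≠ i → ∀ y, y ∉ Set.range s → v i y < v i (s k))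
    {D : Finset V} (hD : Dominant v D) (hcard : D.card + 1 = Fintype.card I)
    {t : V} (htD : t ∈ D) (ht : t ∉ Set.range s) :
    (univ.filter fun y => y ∉ D ∧ Dominant v (insert y D)).card = 2 := by
  have hmin : ∀ i, ∃ m ∈ D, ∀ u ∈ D, v i m ≤ v i u := fun i =>
    D.exists_min_image (v i) ⟨t, htD⟩
  choose m hmD hm using hmin
  have hsurj : ∀ u ∈ D, ∃ l, m l = u := by
    intro u hu
    obtain ⟨l, hl⟩ := hD u
    exact ⟨l, hv l (le_antisymm (hm l u hu) (hl _ (hmD l)))⟩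
  obtain ⟨i, -, j, -, hij, hmij⟩ := exists_ne_map_eq_of_card_lt_of_maps_to
    (s := (univ : Finset I)) (t := D) (f := m) (by rw [card_univ]; omega) (fun l _ => hmD l)
  have hsurj' : ∀ k, (k = i ∨ k = j) → ∀ u ∈ D, ∃ l, l ≠ k ∧ m l = u := by
    intro k hk u hu
    obtain ⟨l, hl⟩ := hsurj u hu
    by_cases hlk : l = k
    · rcases hk with rfl | rfl
      · exact ⟨j, hij.symm, by rw [← hmij, ← hlk, hl]⟩
      · exact ⟨i, hij, by rw [hmij, ← hlk, hl]⟩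
    · exact ⟨l, hlk, hl⟩
  let M : I → V → Prop := fun k y => ∀ l, l ≠ k → v l (m l) < v l y
  have hMne : ∀ k, ∃ y, M k y ∧ ∀ z, M k z → v k z ≤ v k y := by
    intro k
    obtain ⟨y, hy, hy'⟩ := (univ.filter (M k)).exists_max_image (v k)
      ⟨s k, by
        simp only [mem_filter, mem_univ, true_and]
        intro l hl
        exact (hm l t htD).trans_lt (hs l k hl.symm t ht)⟩
    exact ⟨y, by simpa using hy, fun z hz => hy' z (by simpa using hz)⟩
  have hlow : ∀ k y, M k y → ∀ u ∈ D, v k y ≤ v k u := by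
    intro k y hy u hu
    obtain ⟨l, hl⟩ := hD y
    by_cases hlk : l = k
    · subst hlk; exact hl u hu
    · exact absurd (hl _ (hmD l)) (not_le.2 (hy l hlk))
  have hmem : ∀ k, (k = i ∨ k = j) → ∀ y, M k y → (∀ z, M k z → v k z ≤ v k y) →
      y ∉ D ∧ Dominant v (insert y D) := by
    intro k hk y hy hmax
    refine ⟨fun hyD => ?_, fun z => ?_⟩
    · obtain ⟨l, hlk, hl⟩ := hsurj' k hk y hyD
      have := hy l hlk
      rw [hl] at this
      exact lt_irrefl _ this
    · by_cases hz : M k z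
      · refine ⟨k, fun u hu => ?_⟩
        rcases mem_insert.1 hu with rfl | hu
        · exact hmax z hz
        · exact hlow k z hz u hu
      · simp only [M, not_forall, not_lt] at hz
        obtain ⟨l, hlk, hl⟩ := hz
        refine ⟨l, fun u hu => ?_⟩
        rcases mem_insert.1 hu with rfl | hu
        · exact hl.trans (hy l hlk).le
        · exact hl.trans (hm l u hu)
  have hconv : ∀ y, y ∉ D → Dominant v (insert y D) →
      ∃ k, (k = i ∨ k = j) ∧ M k y ∧ ∀ z, M k z → v k z ≤ v k y := by
    intro y hyD hdom
    obtain ⟨k, hk⟩ := hdom y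
    let L := univ.filter fun l => v l (m l) < v l y
    have hkL : k ∉ L := by
      simp only [L, mem_filter, mem_univ, true_and, not_lt]
      exact hk _ (mem_insert_of_mem (hmD k))
    have hDL : D ⊆ L.image m := by
      intro u hu
      obtain ⟨l, hl⟩ := hdom u
      have hul : m l = u := hv l (le_antisymm (hm l u hu) (hl _ (mem_insert_of_mem (hmD l))))
      refine mem_image.2 ⟨l, ?_, hul⟩
      simp only [L, mem_filter, mem_univ, true_and, hul]
      refine lt_of_le_of_ne (hl y (mem_insert_self _ _)) fun h => hyD ?_
      rw [← hv l h]
      exact hu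
    have hLsub : L ⊆ univ.erase k := fun l hl =>
      mem_erase.2 ⟨fun h => hkL (h ▸ hl), mem_univ _⟩
    have hc1 : (univ.erase k).card = D.card := by
      rw [card_erase_of_mem (mem_univ k), card_univ]; omega
    have hc2 : D.card ≤ L.card := (card_le_card hDL).trans card_image_le
    have hL : L = univ.erase k := eq_of_subset_of_card_le hLsub (by omega)
    have hM : M k y := by
      intro l hl
      have : l ∈ L := by rw [hL]; exact mem_erase.2 ⟨hl, mem_univ _⟩
      exact (mem_filter.1 this).2
    refine ⟨k, ?_, hM, fun z hz => ?_⟩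
    · by_contra hne
      push Not at hne
      have hinj : Set.InjOn m L := card_image_iff.1
        (le_antisymm card_image_le (by
          calc L.card = D.card := by rw [hL, hc1]
            _ ≤ _ := card_le_card hDL))
      refine hij (hinj ?_ ?_ hmij) <;> rw [mem_coe, hL]
      · exact mem_erase.2 ⟨hne.1.symm, mem_univ _⟩
      · exact mem_erase.2 ⟨hne.2.symm, mem_univ _⟩
    · obtain ⟨l, hl⟩ := hdom z
      by_cases hlk : l = k
      · subst hlk; exact hl y (mem_insert_self _ _)
      · exact absurd (hl _ (mem_insert_of_mem (hmD l))) (not_le.2 (hz l hlk))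
  obtain ⟨a, ha, ha'⟩ := hMne i
  obtain ⟨b, hb, hb'⟩ := hMne j
  have hab : a ≠ b := by
    rintro rfl
    exact absurd (hlow j a hb _ (hmD j)) (not_le.2 (ha j hij.symm))
  rw [card_eq_two]
  refine ⟨a, b, hab, ?_⟩
  ext y
  simp only [mem_filter, mem_univ, true_and, mem_insert, mem_singleton]
  constructor
  · rintro ⟨h1, h2⟩
    obtain ⟨k, rfl | rfl, hk, hk'⟩ := hconv y h1 h2
    · exact Or.inl (hv _ (le_antisymm (ha' y hk) (hk' a ha)))
    · exact Or.inr (hv _ (le_antisymm (hb' y hk) (hk' b hb)))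
  · rintro (rfl | rfl)
    · exact hmem i (Or.inl rfl) y ha ha'
    · exact hmem j (Or.inr rfl) y hb hb'

open Classical in
/-- The set of all slack points but one extends to a dominant set in exactly one way. -/
theorem card_dominant_insert_slack_eq_one (hv : ∀ i, Function.Injective (v i)) (s : I → V)
    (hmin : ∀ i y, v i (s i) ≤ v i y)
    (hs : ∀ i k, k ≠ i → ∀ y, y ∉ Set.range s → v i y < v i (s k))
    (hne : ∃ t, t ∉ Set.range s) (o : I) :
    (univ.filter fun y => y ∉ (univ.erase o).image s ∧
      Dominant v (insert y ((univ.erase o).image s))).card = 1 := by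
  obtain ⟨t, ht⟩ := hne
  obtain ⟨a, ha, ha'⟩ := (univ.filter fun y => y ∉ Set.range s).exists_max_image (v o)
    ⟨t, by simpa using ht⟩
  have ha : a ∉ Set.range s := (mem_filter.1 ha).2
  have ha' : ∀ z, z ∉ Set.range s → v o z ≤ v o a := fun z hz =>
    ha' z (mem_filter.2 ⟨mem_univ _, hz⟩)
  have hsD : ∀ k, k ≠ o → s k ∈ (univ.erase o).image s := fun k hk =>
    mem_image_of_mem _ (mem_erase.2 ⟨hk, mem_univ _⟩)
  have hbig : ∀ i z, z ∉ Set.range s → ¬ v i z ≤ v i (s i) := fun i z hz h =>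
    hz ⟨i, hv i (le_antisymm (hmin i z) h)⟩
  rw [card_eq_one]
  refine ⟨a, ?_⟩
  ext y
  simp only [mem_filter, mem_univ, true_and, mem_singleton]
  constructor
  · rintro ⟨hyD, hdom⟩
    have key : ∀ z, z ∉ Set.range s → v o z ≤ v o y := by
      intro z hz
      obtain ⟨l, hl⟩ := hdom z
      by_cases hlo : l = o
      · subst hlo; exact hl y (mem_insert_self _ _)
      · exact absurd (hl _ (mem_insert_of_mem (hsD l hlo))) (hbig l z hz)
    have hy : y ∉ Set.range s := by
      rintro ⟨k, rfl⟩
      by_cases hk : k = o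
      · subst hk; exact hbig k t ht (key t ht)
      · exact hyD (hsD k hk)
    exact hv o (le_antisymm (ha' y hy) (key a ha))
  · rintro rfl
    refine ⟨fun h => ?_, fun z => ?_⟩
    · obtain ⟨k, -, hk⟩ := mem_image.1 h
      exact ha ⟨k, hk⟩
    · by_cases hz : z ∈ Set.range s
      · obtain ⟨k, rfl⟩ := hz
        exact ⟨k, fun u _ => hmin k u⟩
      · refine ⟨o, fun u hu => ?_⟩
        rcases mem_insert.1 hu with rfl | hu
        · exact ha' z hz
        · obtain ⟨k, hk, rfl⟩ := mem_image.1 hu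
          exact (hs o k (ne_of_mem_erase hk) z hz).le

/-- Scarf's lemma: a colouring that assigns each slack point its own colour admits a dominant set
meeting each colour exactly once. -/
theorem exists_dominant_image_eq_univ (hv : ∀ i, Function.Injective (v i)) (s : I → V)
    (hmin : ∀ i y, v i (s i) ≤ v i y)
    (hs : ∀ i k, k ≠ i → ∀ y, y ∉ Set.range s → v i y < v i (s k))
    (hne : ∃ t, t ∉ Set.range s) (c : V → I) (hc : ∀ i, c (s i) = i) [Nonempty I] :
    ∃ U : Finset V, Dominant v U ∧ U.card = Fintype.card I ∧ U.image c = univ := by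
  classical
  obtain ⟨o⟩ := ‹Nonempty I›
  have hsinj : Function.Injective s := fun i j h => by rw [← hc i, h, hc]
  by_contra hno
  push Not at hno
  let R : Finset (Finset V) := univ.filter fun U => Dominant v U ∧ U.card = Fintype.card I
  let E : Finset (Finset V) := univ.filter fun D =>
    Dominant v D ∧ D.card + 1 = Fintype.card I ∧ D.image c = univ.erase o
  have hcount : ∑ U ∈ R, (U.filter fun x => (U.erase x).image c = univ.erase o).card =
      ∑ D ∈ E, (univ.filter fun y => y ∉ D ∧ Dominant v (insert y D)).card := by
    rw [← card_sigma, ← card_sigma]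
    refine card_nbij' (fun q => ⟨q.1.erase q.2, q.2⟩) (fun q => ⟨insert q.2 q.1, q.2⟩) ?_ ?_ ?_ ?_
    · rintro ⟨U, x⟩ h
      simp only [coe_sigma, Set.mem_sigma_iff, mem_coe, mem_filter, mem_univ, true_and, R, E]
        at h ⊢
      obtain ⟨⟨h1, h2⟩, h3, h4⟩ := h
      refine ⟨⟨h1.mono (erase_subset _ _), ?_, h4⟩, notMem_erase _ _, ?_⟩
      · rw [card_erase_add_one h3, h2]
      · rwa [insert_erase h3]
    · rintro ⟨D, y⟩ h
      simp only [coe_sigma, Set.mem_sigma_iff, mem_coe, mem_filter, mem_univ, true_and, R, E]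
        at h ⊢
      obtain ⟨⟨-, h2, h3⟩, h4, h5⟩ := h
      refine ⟨⟨h5, ?_⟩, mem_insert_self _ _, ?_⟩
      · rw [card_insert_of_notMem h4, h2]
      · rwa [erase_insert h4]
    · rintro ⟨U, x⟩ h
      simp only [coe_sigma, Set.mem_sigma_iff, mem_coe, mem_filter] at h
      simp [insert_erase h.2.1]
    · rintro ⟨D, y⟩ h
      simp only [coe_sigma, Set.mem_sigma_iff, mem_coe, mem_filter] at h
      simp [erase_insert h.2.2.1]
  have heven : Even (∑ U ∈ R, (U.filter fun x => (U.erase x).image c = univ.erase o).card) := by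
    refine even_sum _ fun U hU => ?_
    have hU := (mem_filter.1 hU).2
    exact even_card_erase_image_eq c o hU.2 (hno U hU.1 hU.2)
  have hone := card_dominant_insert_slack_eq_one hv s hmin hs hne o
  set O := (univ.erase o).image s with hO
  have hOE : O ∈ E := by
    obtain ⟨y, hy⟩ := card_pos.1 (hone ▸ Nat.one_pos)
    refine mem_filter.2 ⟨mem_univ _, (mem_filter.1 hy).2.2.mono (subset_insert _ _), ?_, ?_⟩
    · rw [hO, card_image_of_injective _ hsinj, card_erase_add_one (mem_univ o), card_univ]
    · rw [hO, image_image]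
      simp [Function.comp_def, hc]
  rw [hcount, ← add_sum_erase _ _ hOE, hone] at heven
  have hrest : Even (∑ D ∈ E.erase O,
      (univ.filter fun y => y ∉ D ∧ Dominant v (insert y D)).card) := by
    refine even_sum _ fun D hD => ?_
    obtain ⟨hDO, hD⟩ := mem_erase.1 hD
    obtain ⟨-, h1, h2, h3⟩ := mem_filter.1 hD
    have : ∃ t ∈ D, t ∉ Set.range s := by
      by_contra hall
      push Not at hall
      refine hDO (eq_of_subset_of_card_le (fun u hu => ?_) ?_)
      · obtain ⟨k, rfl⟩ := hall u hu
        refine mem_image_of_mem _ ?_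
        rw [← h3, ← hc k]
        exact mem_image.2 ⟨s k, hu, by simp [hc]⟩
      · have := (mem_filter.1 hOE).2.2.1
        omega
    obtain ⟨t, htD, ht⟩ := this
    rw [card_dominant_insert_eq_two hv s hs h1 h2 htD ht]
    exact even_two
  rw [Nat.even_add] at heven
  exact Nat.not_even_one (heven.2 hrest)

end Scarf

section Brouwer

variable {ι : Type*} [Fintype ι]

/-- A point of the grid simplex `{a : ι → ℕ | ∑ i, a i = N}` such that every coordinate is small or
is the colour of a nearby grid point. -/
theorem exists_grid_point_near_all_colors [Nonempty ι] (N : ℕ)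
    (col : (ι → ℕ) → ι) :
    ∃ a : ι → ℕ, ∑ i, a i = N ∧ ∀ i, a i < Fintype.card ι ∨
      ∃ b : ι → ℕ, ∑ i, b i = N ∧ col b = i ∧
        ∀ j, a j < b j + Fintype.card ι ∧ b j < a j + Fintype.card ι := by
  classical
  let T := {a : ι → ℕ // a ∈ piAntidiag univ N}
  have hT : ∀ a : ι → ℕ, a ∈ piAntidiag univ N ↔ ∑ i, a i = N := fun a => by simp
  have : Fintype T := FinsetCoe.fintype _
  let e := Fintype.equivFin (T ⊕ ι)
  let w : ι → T ⊕ ι → ℤ := fun i => Sum.elim (fun a => (a.1 i : ℤ))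
    (fun k => if k = i then -1 else N + 1)
  let v : ι → T ⊕ ι → ℤ ×ₗ ℕ := fun i x => toLex (w i x, (e x).val)
  have hv : ∀ i, Function.Injective (v i) := by
    intro i x y h
    have := (Prod.ext_iff.1 (toLex.injective h)).2
    exact e.injective (Fin.ext this)
  have hlt : ∀ i x y, w i x < w i y → v i x < v i y := fun i x y h =>
    Prod.Lex.toLex_lt_toLex.2 (Or.inl h)
  have hle : ∀ i x y, v i x ≤ v i y → w i x ≤ w i y := fun i x y h => by
    by_contra hh
    exact absurd h (not_le.2 (hlt i y x (not_le.1 hh)))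
  have hinl : ∀ y : T ⊕ ι, y ∉ Set.range (Sum.inr : ι → T ⊕ ι) ↔ ∃ t, y = Sum.inl t := by
    rintro (t | k) <;> simp
  have hbound : ∀ (t : T) i, t.1 i ≤ N := fun t i => by
    exact (single_le_sum (f := t.1) (fun _ _ => Nat.zero_le _) (mem_univ i)).trans_eq
      ((hT t.1).1 t.2)
  have hmin : ∀ i y, v i (Sum.inr i) ≤ v i y := by
    rintro i (t | k)
    · refine (hlt _ _ _ ?_).le
      simp only [w, Sum.elim_inl, Sum.elim_inr, if_true]
      omega
    · by_cases hk : k = i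
      · rw [hk]
      · refine (hlt _ _ _ ?_).le
        simp only [w, Sum.elim_inr, if_true, if_neg hk]
        omega
  have hs : ∀ i k, k ≠ i → ∀ y, y ∉ Set.range (Sum.inr : ι → T ⊕ ι) →
      v i y < v i (Sum.inr k) := by
    intro i k hk y hy
    obtain ⟨t, rfl⟩ := (hinl y).1 hy
    refine hlt _ _ _ ?_
    simp only [w, Sum.elim_inl, Sum.elim_inr, if_neg hk]
    have := hbound t i
    omega
  obtain ⟨i₀⟩ := id ‹Nonempty ι›
  let t₀ : T := ⟨Pi.single i₀ N, (hT _).2 (by simp)⟩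
  obtain ⟨U, hdom, -, hcol⟩ := exists_dominant_image_eq_univ hv Sum.inr hmin hs
    ⟨Sum.inl t₀, by simp⟩ (Sum.elim (fun t => col t.1) id) (fun _ => rfl)
  have hdom' : ∀ y : T, ∃ i, Sum.inr i ∉ U ∧ ∀ u : T, Sum.inl u ∈ U → y.1 i ≤ u.1 i := by
    intro y
    obtain ⟨i, hi⟩ := hdom (Sum.inl y)
    refine ⟨i, fun h => ?_, fun u hu => ?_⟩
    · have := hle _ _ _ (hi _ h)
      simp only [w, Sum.elim_inl, Sum.elim_inr, if_true] at this
      omega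
    · have := hle _ _ _ (hi _ hu)
      simpa [w] using this
  let C : Finset ι := univ.filter fun i => Sum.inr i ∉ U
  have hC : ∀ i, i ∈ C ↔ Sum.inr i ∉ U := fun i => by simp [C]
  obtain ⟨i₁, hi₁, -⟩ := hdom' t₀
  let P : Finset T := univ.filter fun t => Sum.inl t ∈ U
  have hP : ∀ t, t ∈ P ↔ Sum.inl t ∈ U := fun t => by simp [P]
  have hcolT : ∀ i, i ∈ C → ∃ t ∈ P, col t.1 = i := by
    intro i hi
    obtain ⟨x | k, hx, hxi⟩ := mem_image.1 (hcol ▸ mem_univ i)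
    · exact ⟨x, (hP x).2 hx, hxi⟩
    · simp only [Sum.elim_inr, id] at hxi
      subst hxi
      exact absurd hx ((hC k).1 hi)
  obtain ⟨a, haP, -⟩ := hcolT i₁ ((hC _).2 hi₁)
  have hm : ∀ i, ∃ m ∈ P, ∀ u ∈ P, m.1 i ≤ u.1 i := fun i =>
    P.exists_min_image (fun u => u.1 i) ⟨a, haP⟩
  choose m hmP hm using hm
  have hbig : N < ∑ i ∈ C, ((m i).1 i + 1) := by
    by_contra hle
    push Not at hle
    let y : ι → ℕ := fun i => (if i ∈ C then (m i).1 i + 1 else 0) +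
      (Pi.single i₁ (N - ∑ i ∈ C, ((m i).1 i + 1)) : ι → ℕ) i
    have hy : ∑ i, y i = N := by
      simp only [y, sum_add_distrib, sum_ite_mem, univ_inter]
      rw [← sum_add_distrib, sum_pi_single']
      simp only [mem_univ, if_true]
      omega
    obtain ⟨i, hiU, hi⟩ := hdom' ⟨y, (hT y).2 hy⟩
    have := hi _ ((hP _).1 (hmP i))
    simp only [y, if_pos ((hC i).2 hiU)] at this
    omega
  have hcardC : C.card ≤ Fintype.card ι := card_le_univ C
  rw [sum_add_distrib, sum_const, smul_eq_mul, mul_one] at hbig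
  have hkey : ∀ u ∈ P, ∀ j, u.1 j + ∑ i ∈ C.erase j, (m i).1 i ≤ N := by
    intro u hu j
    calc u.1 j + ∑ i ∈ C.erase j, (m i).1 i ≤ u.1 j + ∑ i ∈ univ.erase j, u.1 i := by
          refine Nat.add_le_add_left ((sum_le_sum fun i _ => hm i u hu).trans ?_) _
          exact sum_le_sum_of_subset (erase_subset_erase _ (subset_univ _))
      _ = N := by rw [add_sum_erase _ _ (mem_univ j), (hT u.1).1 u.2]
  have hclose : ∀ u ∈ P, ∀ j, u.1 j < Fintype.card ι ∨
      ((m j).1 j ≤ u.1 j ∧ u.1 j < (m j).1 j + Fintype.card ι) := by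
    intro u hu j
    have h1 := hkey u hu j
    by_cases hj : j ∈ C
    · rw [← add_sum_erase _ _ hj] at hbig
      exact Or.inr ⟨hm j u hu, by omega⟩
    · rw [erase_eq_of_notMem hj] at h1
      exact Or.inl (by omega)
  refine ⟨a.1, (hT _).1 a.2, fun i => ?_⟩
  by_cases hi : i ∈ C
  · obtain ⟨b, hbP, hb⟩ := hcolT i hi
    refine Or.inr ⟨b.1, (hT _).1 b.2, hb, fun j => ?_⟩
    have h1 := hclose a haP j
    have h2 := hclose b hbP j
    have h3 := hm j a haP
    have h4 := hm j b hbP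
    omega
  · refine Or.inl ?_
    have h1 := hkey a haP i
    rw [erase_eq_of_notMem hi] at h1
    omega

open Filter Topology in
/-- Brouwer's fixed point theorem for the standard simplex. -/
theorem exists_fixedPoint_stdSimplex [Nonempty ι] {f : (ι → ℝ) → ι → ℝ} (hf : Continuous f)
    (hmaps : ∀ x ∈ stdSimplex ℝ ι, f x ∈ stdSimplex ℝ ι) : ∃ x ∈ stdSimplex ℝ ι, f x = x := by
  classical
  let K : ℝ := Fintype.card ι
  let sc : ℕ → (ι → ℕ) → ι → ℝ := fun N a i => (a i : ℝ) / (N + 1 : ℕ)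
  have hsc : ∀ N a, ∑ i, a i = N + 1 → sc N a ∈ stdSimplex ℝ ι := by
    intro N a ha
    refine ⟨fun i => by positivity, ?_⟩
    simp only [sc]
    rw [← sum_div, ← Nat.cast_sum, ha]
    exact div_self (by positivity)
  have hcolor : ∀ x ∈ stdSimplex ℝ ι, ∃ i, x i ≤ f x i := by
    intro x hx
    by_contra h
    push Not at h
    have := sum_lt_sum_of_nonempty univ_nonempty fun i _ => h i
    rw [hx.2, (hmaps x hx).2] at this
    exact lt_irrefl _ this
  have hcol : ∀ N, ∃ col : (ι → ℕ) → ι, ∀ a, ∑ i, a i = N + 1 →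
      sc N a (col a) ≤ f (sc N a) (col a) := by
    intro N
    have : ∀ a : ι → ℕ, ∃ i, ∑ i, a i = N + 1 → sc N a i ≤ f (sc N a) i := by
      intro a
      by_cases ha : ∑ i, a i = N + 1
      · obtain ⟨i, hi⟩ := hcolor _ (hsc N a ha)
        exact ⟨i, fun _ => hi⟩
      · exact ⟨Classical.arbitrary ι, fun h => absurd h ha⟩
    choose col hcol using this
    exact ⟨col, hcol⟩
  have happrox : ∀ N : ℕ, ∃ x ∈ stdSimplex ℝ ι, ∀ i, ∃ y ∈ stdSimplex ℝ ι,
      (∀ j, |y j - x j| ≤ K / (N + 1 : ℕ)) ∧ y i - K / (N + 1 : ℕ) ≤ f y i := by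
    intro N
    obtain ⟨col, hcol⟩ := hcol N
    obtain ⟨a, ha, hnear⟩ := exists_grid_point_near_all_colors (N + 1) col
    have hN : (0 : ℝ) < (N + 1 : ℕ) := by positivity
    have hK : 0 ≤ K / (N + 1 : ℕ) := by positivity
    refine ⟨sc N a, hsc N a ha, fun i => ?_⟩
    rcases hnear i with hi | ⟨b, hb, hbi, hab⟩
    · refine ⟨sc N a, hsc N a ha, fun j => by simpa using hK, ?_⟩
      refine le_trans ?_ ((hmaps _ (hsc N a ha)).1 i)
      have : (a i : ℝ) ≤ K := by simp only [K]; exact_mod_cast hi.le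
      have := div_le_div_of_nonneg_right this hN.le
      simp only [sc]
      linarith
    · refine ⟨sc N b, hsc N b hb, fun j => ?_, ?_⟩
      · have h1 : (a j : ℝ) ≤ b j + K := by simp only [K]; exact_mod_cast (hab j).1.le
        have h2 : (b j : ℝ) ≤ a j + K := by simp only [K]; exact_mod_cast (hab j).2.le
        simp only [sc]
        rw [← sub_div, abs_div, abs_of_pos hN]
        refine div_le_div_of_nonneg_right (abs_le.2 ⟨by linarith, by linarith⟩) hN.le
      · have := hcol b hb
        rw [hbi] at this
        linarith
  choose x hx y hy hxy hfy using happrox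
  obtain ⟨z, hz, φ, hφ, hlim⟩ := (isCompact_stdSimplex ℝ ι).tendsto_subseq hx
  have hK : Tendsto (fun N : ℕ => K / ((φ N + 1 : ℕ) : ℝ)) atTop (𝓝 0) :=
    (tendsto_const_div_atTop_nhds_zero_nat K).comp
      ((tendsto_add_atTop_nat 1).comp hφ.tendsto_atTop)
  have hy_lim : ∀ i, Tendsto (fun N => y (φ N) i) atTop (𝓝 z) := by
    intro i
    rw [tendsto_pi_nhds] at hlim ⊢
    intro j
    have h0 : Tendsto (fun N => y (φ N) i j - x (φ N) j) atTop (𝓝 0) :=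
      squeeze_zero_norm (fun N => by simpa using hxy (φ N) i j) hK
    simpa using h0.add (hlim j)
  have hle : ∀ i, z i ≤ f z i := by
    intro i
    have h1 : Tendsto (fun N => y (φ N) i i - K / ((φ N + 1 : ℕ) : ℝ)) atTop (𝓝 (z i - 0)) :=
      ((tendsto_pi_nhds.1 (hy_lim i)) i).sub hK
    have h2 : Tendsto (fun N => f (y (φ N) i) i) atTop (𝓝 (f z i)) :=
      (tendsto_pi_nhds.1 ((hf.tendsto z).comp (hy_lim i))) i
    rw [sub_zero] at h1
    exact le_of_tendsto_of_tendsto' h1 h2 fun N => hfy (φ N) i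
  refine ⟨z, hz, ?_⟩
  have hsum : ∑ i, z i = ∑ i, f z i := by rw [hz.2, (hmaps z hz).2]
  funext i
  exact (((sum_eq_sum_iff_of_le fun i _ => hle i).1 hsum) i (mem_univ i)).symm

end Brouwer

section NashDistribution

/-- Gibbs variational principle: the softmax distribution maximizes expected payoff plus scaled
entropy over the simplex. -/
theorem softmax_maximizes_entropy_perturbed {B : Type*} [Fintype B] {τ : ℝ}
    (hτ : 0 < τ) (q ρ : B → ℝ) (hρ : ∀ b, ρ b = Real.exp (q b / τ) / ∑ b, Real.exp (q b / τ))
    (μ : B → ℝ) (hμ : μ ∈ stdSimplex ℝ B) :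
    ∑ b, μ b * q b + τ * (-∑ b, μ b * Real.log (μ b)) ≤
      ∑ b, ρ b * q b + τ * (-∑ b, ρ b * Real.log (ρ b)) := by
  have hB : Nonempty B := by
    by_contra h
    rw [not_nonempty_iff] at h
    simpa using hμ.2
  set Z := ∑ b, Real.exp (q b / τ) with hZ
  have hZpos : 0 < Z := sum_pos (fun b _ => Real.exp_pos _) univ_nonempty
  have hρpos : ∀ b, 0 < ρ b := fun b => by rw [hρ]; positivity
  have hρsum : ∑ b, ρ b = 1 := by
    simp only [hρ]
    rw [← sum_div, ← hZ, div_self hZpos.ne']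
  have hq : ∀ b, q b = τ * (Real.log (ρ b) + Real.log Z) := by
    intro b
    rw [hρ, Real.log_div (Real.exp_pos _).ne' hZpos.ne', Real.log_exp]
    field_simp
    ring
  have hval : ∀ ν : B → ℝ, ∑ b, ν b = 1 →
      ∑ b, ν b * q b + τ * (-∑ b, ν b * Real.log (ν b)) =
        τ * Real.log Z + τ * ∑ b, ν b * (Real.log (ρ b) - Real.log (ν b)) := by
    intro ν hν
    calc _ = (∑ b, ν b) * (τ * Real.log Z) +
          τ * ∑ b, ν b * (Real.log (ρ b) - Real.log (ν b)) := by
          rw [sum_mul, ← sum_neg_distrib, mul_sum, mul_sum, ← sum_add_distrib, ← sum_add_distrib]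
          refine sum_congr rfl fun b _ => ?_
          rw [hq b]
          ring
      _ = _ := by rw [hν, one_mul]
  rw [hval μ hμ.2, hval ρ hρsum]
  simp only [sub_self, mul_zero, sum_const_zero, add_zero]
  have : ∑ b, μ b * (Real.log (ρ b) - Real.log (μ b)) ≤ ∑ b, (ρ b - μ b) := by
    refine sum_le_sum fun b _ => ?_
    rcases (hμ.1 b).eq_or_lt with h | h
    · rw [← h]; simpa using (hρpos b).le
    · rw [← Real.log_div (hρpos b).ne' h.ne']
      calc μ b * Real.log (ρ b / μ b) ≤ μ b * (ρ b / μ b - 1) :=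
            mul_le_mul_of_nonneg_left (Real.log_le_sub_one_of_pos (by have := hρpos b; positivity))
              h.le
        _ = ρ b - μ b := by field_simp
  rw [sum_sub_distrib, hρsum, hμ.2, sub_self] at this
  nlinarith

variable {n : ℕ} {A : Fin n → Type*} [∀ i, Fintype (A i)]

open Classical in
/-- The expected payoff to player `i` from the pure action `b` when the others play `x`. -/
noncomputable def pureActionPayoff (u : Fin n → (∀ j, A j) → ℝ) (x : ∀ i, A i → ℝ) (i : Fin n)
    (b : A i) : ℝ :=
  ∑ a : ∀ j, A j, (if a i = b then 1 else 0) * ((∏ j ∈ univ.erase i, x j (a j)) * u i a)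

theorem sum_mul_pureActionPayoff (u : Fin n → (∀ j, A j) → ℝ) (x : ∀ i, A i → ℝ) (i : Fin n)
    (μ : A i → ℝ) :
    ∑ b, μ b * pureActionPayoff u x i b =
      ∑ a : ∀ j, A j, μ (a i) * (∏ j ∈ univ.erase i, x j (a j)) * u i a := by
  classical
  simp only [pureActionPayoff, mul_sum]
  rw [sum_comm]
  refine sum_congr rfl fun a _ => ?_
  rw [sum_eq_single (a i) (fun b _ hb => by rw [if_neg hb.symm]; ring) (by simp)]
  simp [mul_assoc]

/-- Every finite game has a Nash distribution for the entropy perturbation. -/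
theorem exists_nash_distribution [∀ i, Nonempty (A i)] {τ : ℝ} (hτ : 0 < τ)
    (u : Fin n → (∀ j, A j) → ℝ) :
    ∃ x : ∀ i, A i → ℝ, (∀ i, x i ∈ stdSimplex ℝ (A i)) ∧
      ∀ i, ∀ μ ∈ stdSimplex ℝ (A i),
        (∑ a : ∀ j, A j, μ (a i) * (∏ j ∈ univ.erase i, x j (a j)) * u i a)
            + τ * (-∑ b, μ b * Real.log (μ b))
          ≤ (∑ a : ∀ j, A j, x i (a i) * (∏ j ∈ univ.erase i, x j (a j)) * u i a)
            + τ * (-∑ b, x i b * Real.log (x i b)) := by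
  classical
  rcases Nat.eq_zero_or_pos n with rfl | hn
  · exact ⟨fun i => i.elim0, fun i => i.elim0, fun i => i.elim0⟩
  have : Nonempty (Σ i, A i) := ⟨⟨⟨0, hn⟩, Classical.arbitrary _⟩⟩
  have hn' : (0 : ℝ) < n := by exact_mod_cast hn
  let G : (∀ i, A i → ℝ) → ∀ i, A i → ℝ := fun x i b =>
    Real.exp (pureActionPayoff u x i b / τ) / ∑ b, Real.exp (pureActionPayoff u x i b / τ)
  have hZ : ∀ x i, 0 < ∑ b, Real.exp (pureActionPayoff u x i b / τ) := fun x i =>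
    sum_pos (fun b _ => Real.exp_pos _) univ_nonempty
  have hG : ∀ x i, G x i ∈ stdSimplex ℝ (A i) := fun x i =>
    ⟨fun b => div_nonneg (Real.exp_pos _).le (hZ x i).le, by
      simp only [G]
      rw [← sum_div, div_self (hZ x i).ne']⟩
  let scale : ((Σ i, A i) → ℝ) → ∀ i, A i → ℝ := fun y i b => n * y ⟨i, b⟩
  have hcont : ∀ i b, Continuous fun y => pureActionPayoff u (scale y) i b := by
    intro i b
    simp only [pureActionPayoff, scale]
    fun_prop
  obtain ⟨y, -, hy⟩ := exists_fixedPoint_stdSimplex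
    (f := fun y : (Σ i, A i) → ℝ => fun q => G (scale y) q.1 q.2 / n)
    (by
      refine continuous_pi fun q => Continuous.div_const (Continuous.div ?_ ?_ ?_) _
      · exact Real.continuous_exp.comp ((hcont q.1 q.2).div_const _)
      · exact continuous_finsetSum _ fun b _ =>
          Real.continuous_exp.comp ((hcont q.1 b).div_const _)
      · exact fun y => (hZ (scale y) q.1).ne')
    (by
      refine fun y _ => ⟨fun q => div_nonneg ((hG _ _).1 _) hn'.le, ?_⟩
      rw [← sum_div, Fintype.sum_sigma]
      simp only [(hG _ _).2]
      simp [hn'.ne'])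
  have hfix : G (scale y) = scale y := by
    funext i b
    have := congrFun hy ⟨i, b⟩
    simp only at this
    simp only [scale]
    rw [← this]
    field_simp
    rfl
  refine ⟨scale y, fun i => hfix ▸ hG (scale y) i, fun i μ hμ => ?_⟩
  rw [← sum_mul_pureActionPayoff, ← sum_mul_pureActionPayoff]
  exact softmax_maximizes_entropy_perturbed hτ _ _ (fun b => (congrFun (congrFun hfix i) b).symm)
    μ hμ

end NashDistribution

/-- Every finite-horizon stochastic game (horizon `ℓ+1`) admits a
nonstationary Markov Nash distribution `(π_k)` together with its Q-functions `(Q_k)`: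
(i) `Q_ℓ^i = r^i`; (ii) the backward recursion
`Q_k^i(s,a) = r^i(s,a) + γ^i Σ_{s'} p(s'|s,a) E_{a'∼π_{k+1}(s')}[Q_{k+1}^i(s',a')]`;
(iii) each `π_k^i(s)` maximizes the entropy-perturbed expected payoff against
`π_k^{-i}(s)` in the stage game with payoff `Q_k^i(s,·)`. -/
theorem stmt14
    {S : Type*} [Fintype S] [Nonempty S]
    {n : ℕ} {A : Fin n → Type*} [∀ i, Fintype (A i)] [∀ i, Nonempty (A i)]
    (r : Fin n → S → (∀ i, A i) → ℝ)
    (γ : Fin n → ℝ) (hγ : ∀ i, 0 ≤ γ i ∧ γ i < 1)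
    (p : S → (∀ i, A i) → S → ℝ)
    (hp0 : ∀ s a s', 0 ≤ p s a s') (hp1 : ∀ s a, ∑ s', p s a s' = 1)
    (τ : ℝ) (hτ : 0 < τ) (ℓ : ℕ) :
    ∃ (π : ℕ → ∀ i : Fin n, S → A i → ℝ) (Q : ℕ → Fin n → S → (∀ i, A i) → ℝ),
      (∀ k (i : Fin n) (s : S), k ≤ ℓ → π k i s ∈ stdSimplex ℝ (A i)) ∧
      (∀ i s a, Q ℓ i s a = r i s a) ∧
      (∀ k, k < ℓ → ∀ i s a, Q k i s a = r i s a + γ i *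
        ∑ s', p s a s' *
          ∑ a' : ∀ j, A j, (∏ j, π (k + 1) j s' (a' j)) * Q (k + 1) i s' a') ∧
      (∀ k, k ≤ ℓ → ∀ (s : S) (i : Fin n), ∀ μ ∈ stdSimplex ℝ (A i),
        (∑ a : ∀ j, A j, μ (a i) * (∏ j ∈ univ.erase i, π k j s (a j)) * Q k i s a)
            + τ * (-∑ b, μ b * Real.log (μ b))
          ≤ (∑ a : ∀ j, A j,
                π k i s (a i) * (∏ j ∈ univ.erase i, π k j s (a j)) * Q k i s a)
            + τ * (-∑ b, π k i s b * Real.log (π k i s b))) := by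
  classical
  choose nash hnash hmax using fun u : Fin n → (∀ j, A j) → ℝ => exists_nash_distribution hτ u
  let step : (Fin n → S → (∀ i, A i) → ℝ) → Fin n → S → (∀ i, A i) → ℝ := fun q i s a =>
    r i s a + γ i * ∑ s', p s a s' *
      ∑ a' : ∀ j, A j, (∏ j, nash (fun i => q i s') j (a' j)) * q i s' a'
  let V : ℕ → Fin n → S → (∀ i, A i) → ℝ := fun m => step^[m] r
  refine ⟨fun k i s => nash (fun j => V (ℓ - k) j s) i, fun k => V (ℓ - k), ?_, ?_, ?_, ?_⟩
  · exact fun k i s _ => hnash _ i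
  · intro i s a
    simp [V]
  · intro k hk i s a
    obtain ⟨m, hm⟩ : ∃ m, ℓ - k = m + 1 := ⟨ℓ - k - 1, by omega⟩
    have hm' : ℓ - (k + 1) = m := by omega
    simp only [hm, hm', V, Function.iterate_succ_apply']
    rfl
  · exact fun k _ s i μ hμ => hmax _ i μ hμ
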